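/- Let M be an R-module of finite quasi-Gorenstein projective dimension and n ≥ 1 an integer. Then the quasi-Gorenstein projective dimension of M is at most n if and only if Ext^{n+i}(M, Q) = 0 for all i ≥ 1 and all quasi-projective modules Q. -/

import Mathlib

open CategoryTheory

universe u
variable {R : Type u} [Ring R]

/-- A module `Q` is quasi-projective if every homomorphism from `Q` to a quotient
of `Q` lifts to an endomorphism of `Q`. -/
def QuasiProjective (Q : ModuleCat.{u} R) : Prop :=
  ∀ (B : ModuleCat.{u} R) (g : Q ⟶ B), Function.Surjective g →
    ∀ f : Q ⟶ B, ∃ h : Q ⟶ Q, h ≫ g = f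

/-- `M` is quasi-Gorenstein projective if it is a syzygy of an exact complex of
projective modules (given by short exact sequences `0 → K (n+1) → P n → K n → 0`)
that remains exact under `Hom(-, Q)` for every quasi-projective module `Q`. -/
def QuasiGorensteinProjective (M : ModuleCat.{u} R) : Prop :=
  ∃ (K P : ℤ → ModuleCat.{u} R) (ι : ∀ n, K (n + 1) ⟶ P n) (π : ∀ n, P n ⟶ K n),
    (∀ n, Module.Projective R (P n)) ∧
    (∀ n, Function.Injective (ι n)) ∧
    (∀ n, Function.Surjective (π n)) ∧
    (∀ n, Function.Exact (ι n) (π n)) ∧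
    (∀ n (Q : ModuleCat.{u} R), QuasiProjective Q →
      ∀ f : K (n + 1) ⟶ Q, ∃ g : P n ⟶ Q, ι n ≫ g = f) ∧
    Nonempty (M ≅ K 0)

/-- `qgpdimLE n M` means the quasi-Gorenstein projective dimension of `M`
is at most `n`: there is a resolution of `M` of length `n` by
quasi-Gorenstein projective modules. -/
def qgpdimLE : ℕ → ModuleCat.{u} R → Prop
  | 0, M => QuasiGorensteinProjective M
  | n + 1, M => ∃ (K G : ModuleCat.{u} R) (f : K ⟶ G) (g : G ⟶ M),
      QuasiGorensteinProjective G ∧ Function.Injective f ∧ Function.Surjective g ∧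
      Function.Exact f g ∧ qgpdimLE n K

/-- The quasi-Gorenstein projective dimension of `M`, as an element of `ℕ∞`
(`⊤` if no finite resolution exists). -/
noncomputable def qgpdim (M : ModuleCat.{u} R) : ℕ∞ :=
  sInf ((fun m : ℕ => (m : ℕ∞)) '' {m : ℕ | qgpdimLE m M})


section Bridge
open Limits

lemma ext_subsingleton_iff_proj {M : ModuleCat.{u} R} (P : ProjectiveResolution M)
    (Q : ModuleCat.{u} R) (n : ℕ) :
    Subsingleton (Abelian.Ext.{u} M Q (n + 1)) ↔
      ∀ f : P.complex.X (n + 1) ⟶ Q, P.complex.d (n + 2) (n + 1) ≫ f = 0 →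
        ∃ g : P.complex.X n ⟶ Q, P.complex.d (n + 1) n ≫ g = f := by
  constructor
  · intro h f hf
    exact (P.extMk_eq_zero_iff f (n + 2) rfl hf n rfl).1 (Subsingleton.elim _ _)
  · intro h
    refine subsingleton_of_forall_eq 0 fun α => ?_
    obtain ⟨f, hf, rfl⟩ := P.extMk_surjective α (n + 2) rfl
    exact (P.extMk_eq_zero_iff f (n + 2) rfl hf n rfl).2 (h f hf)

lemma old_ext_subsingleton_iff_proj {M : ModuleCat.{u} R} (P : ProjectiveResolution M)
    (Q : ModuleCat.{u} R) (n : ℕ) :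
    Subsingleton (((_root_.Ext ℤ (ModuleCat.{u} R) (n + 1)).obj (Opposite.op M)).obj Q) ↔
      ∀ f : P.complex.X (n + 1) ⟶ Q, P.complex.d (n + 2) (n + 1) ≫ f = 0 →
        ∃ g : P.complex.X n ⟶ Q, P.complex.d (n + 1) n ≫ g = f := by
  rw [← ModuleCat.isZero_iff_subsingleton, (P.isoExt (R := ℤ) (n + 1) Q).isZero_iff,
    ← HomologicalComplex.exactAt_iff_isZero_homology,
    HomologicalComplex.exactAt_iff' _ n (n + 1) (n + 2) (by simp) (by simp),
    ShortComplex.moduleCat_exact_iff]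
  exact Iff.rfl

lemma old_ext_iff (M Q : ModuleCat.{u} R) (n : ℕ) :
    Subsingleton (((_root_.Ext ℤ (ModuleCat.{u} R) (n + 1)).obj (Opposite.op M)).obj Q) ↔
      Subsingleton (Abelian.Ext.{u} M Q (n + 1)) := by
  let P := ProjectiveResolution.of M
  rw [ext_subsingleton_iff_proj P, old_ext_subsingleton_iff_proj P]

/-- Short exact sequences, elementwise. -/
structure SES {A B C : ModuleCat.{u} R} (f : A ⟶ B) (g : B ⟶ C) : Prop where
  inj : Function.Injective f
  surj : Function.Surjective g
  exact : Function.Exact f g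

namespace SES
variable {A B C : ModuleCat.{u} R} {f : A ⟶ B} {g : B ⟶ C}

lemma zero (h : SES f g) : f ≫ g = 0 := by
  ext x
  exact h.exact.apply_apply_eq_zero x

lemma shortExact (h : SES f g) : (ShortComplex.mk f g h.zero).ShortExact where
  exact := (ShortComplex.ShortExact.moduleCat_exact_iff_function_exact _).2 h.exact
  mono_f := (ModuleCat.mono_iff_injective _).2 h.inj
  epi_g := (ModuleCat.epi_iff_surjective _).2 h.surj

lemma desc (h : SES f g) {X : ModuleCat.{u} R} (k : B ⟶ X) (hk : f ≫ k = 0) :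
    ∃ l : C ⟶ X, ∀ x, l (g x) = k x := by
  have := h.shortExact.epi_g
  refine ⟨h.shortExact.exact.desc k hk, fun x => ?_⟩
  exact congr($(h.shortExact.exact.g_desc k hk) x)

lemma ext_left (h : SES f g) (Q : ModuleCat.{u} R) (n : ℕ)
    (hB : Subsingleton (Abelian.Ext.{u} B Q n)) (hC : Subsingleton (Abelian.Ext.{u} C Q (n + 1))) :
    Subsingleton (Abelian.Ext.{u} A Q n) := by
  refine subsingleton_of_forall_eq 0 fun x => ?_
  obtain ⟨y, rfl⟩ := Abelian.Ext.contravariant_sequence_exact₁ h.shortExact Q x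
    (add_comm 1 n) (Subsingleton.elim _ _)
  obtain rfl : y = 0 := Subsingleton.elim (h := hB) _ _
  simp

lemma ext_right (h : SES f g) (Q : ModuleCat.{u} R) (n : ℕ)
    (hA : Subsingleton (Abelian.Ext.{u} A Q n)) (hB : Subsingleton (Abelian.Ext.{u} B Q (n + 1))) :
    Subsingleton (Abelian.Ext.{u} C Q (n + 1)) := by
  refine subsingleton_of_forall_eq 0 fun x => ?_
  obtain ⟨y, rfl⟩ := Abelian.Ext.contravariant_sequence_exact₃ h.shortExact Q x
    (Subsingleton.elim (h := hB) _ _) (add_comm 1 n)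
  obtain rfl : y = 0 := Subsingleton.elim (h := hA) _ _
  simp

lemma ext_mid (h : SES f g) (Q : ModuleCat.{u} R) (n : ℕ)
    (hA : Subsingleton (Abelian.Ext.{u} A Q n)) (hC : Subsingleton (Abelian.Ext.{u} C Q n)) :
    Subsingleton (Abelian.Ext.{u} B Q n) := by
  refine subsingleton_of_forall_eq 0 fun x => ?_
  obtain ⟨y, rfl⟩ := Abelian.Ext.contravariant_sequence_exact₂ h.shortExact Q x
    (Subsingleton.elim (h := hA) _ _)
  obtain rfl : y = 0 := Subsingleton.elim (h := hC) _ _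
  simp

lemma extend (h : SES f g) (Q : ModuleCat.{u} R)
    (hC : Subsingleton (Abelian.Ext.{u} C Q 1)) (k : A ⟶ Q) : ∃ l : B ⟶ Q, f ≫ l = k := by
  obtain ⟨y, hy⟩ := Abelian.Ext.contravariant_sequence_exact₁ h.shortExact Q (Abelian.Ext.mk₀ k)
    (add_zero 1) (Subsingleton.elim (h := hC) _ _)
  obtain ⟨l, rfl⟩ := Abelian.Ext.homEquiv₀.symm.surjective y
  refine ⟨l, ?_⟩
  exact Abelian.Ext.homEquiv₀.symm.injective (by simpa [Abelian.Ext.homEquiv₀] using hy)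

lemma ext_one (h : SES f g) (Q : ModuleCat.{u} R) [Projective B]
    (hA : ∀ k : A ⟶ Q, ∃ l : B ⟶ Q, f ≫ l = k) : Subsingleton (Abelian.Ext.{u} C Q 1) := by
  refine subsingleton_of_forall_eq 0 fun x => ?_
  obtain ⟨y, rfl⟩ := Abelian.Ext.contravariant_sequence_exact₃ h.shortExact Q x
    (Abelian.Ext.eq_zero_of_projective _) (add_zero 1)
  obtain ⟨k, rfl⟩ := Abelian.Ext.homEquiv₀.symm.surjective y
  obtain ⟨l, rfl⟩ := hA k
  have := h.shortExact.extClass_comp_assoc (Abelian.Ext.mk₀ l) (h := add_zero 1)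
  rw [Abelian.Ext.mk₀_comp_mk₀] at this
  exact this

end SES
end Bridge

/-- All positive `Ext` into quasi-projectives vanish. -/
def ExtVan (M : ModuleCat.{u} R) : Prop :=
  ∀ (i : ℕ) (Q : ModuleCat.{u} R), QuasiProjective Q → Subsingleton (Abelian.Ext.{u} M Q (i + 1))

/-- One step of a complete resolution. -/
def QStep (A C : ModuleCat.{u} R) : Prop :=
  ∃ (P : ModuleCat.{u} R) (ι : A ⟶ P) (π : P ⟶ C), Module.Projective R P ∧ SES ι π ∧
    ∀ Q : ModuleCat.{u} R, QuasiProjective Q → ∀ f : A ⟶ Q, ∃ g : P ⟶ Q, ι ≫ g = f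

lemma quasiProjective_of_projective (P : ModuleCat.{u} R) (hP : Module.Projective R P) :
    QuasiProjective P := by
  intro B g hg f
  have : Projective P := (IsProjective.iff_projective (R := R) P).1 hP
  have : Epi g := (ModuleCat.epi_iff_surjective _).2 hg
  exact ⟨Projective.factorThru f g, Projective.factorThru_comp f g⟩

lemma qgp_iff (M : ModuleCat.{u} R) : QuasiGorensteinProjective M ↔
    ∃ K : ℤ → ModuleCat.{u} R, (∀ n, QStep (K (n + 1)) (K n)) ∧ Nonempty (M ≅ K 0) := by
  constructor
  · rintro ⟨K, P, ι, π, h1, h2, h3, h4, h5, h6⟩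
    exact ⟨K, fun n => ⟨P n, ι n, π n, h1 n, ⟨h2 n, h3 n, h4 n⟩, h5 n⟩, h6⟩
  · rintro ⟨K, h, h6⟩
    choose P ι π h1 h2 h5 using h
    exact ⟨K, P, ι, π, h1, fun n => (h2 n).inj, fun n => (h2 n).surj, fun n => (h2 n).exact,
      h5, h6⟩

lemma SES.iso_left {A A' B C : ModuleCat.{u} R} {f : A ⟶ B} {g : B ⟶ C} (h : SES f g)
    (e : A' ≅ A) : SES (e.hom ≫ f) g where
  inj := by
    intro x y hxy
    exact e.toLinearEquiv.injective (h.inj (by simpa using hxy))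
  surj := h.surj
  exact := by
    intro y
    rw [h.exact y]
    constructor
    · rintro ⟨a, rfl⟩
      exact ⟨e.inv a, by simp⟩
    · rintro ⟨a, rfl⟩
      exact ⟨e.hom a, by simp⟩

lemma QStep.iso_left {A A' C : ModuleCat.{u} R} (h : QStep A C) (e : A' ≅ A) : QStep A' C := by
  obtain ⟨P, ι, π, h1, h2, h3⟩ := h
  refine ⟨P, e.hom ≫ ι, π, h1, h2.iso_left e, fun Q hQ f => ?_⟩
  obtain ⟨g, hg⟩ := h3 Q hQ (e.inv ≫ f)
  exact ⟨g, by simp [hg]⟩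

lemma QStep.extVan {K : ℤ → ModuleCat.{u} R} (h : ∀ n, QStep (K (n + 1)) (K n)) (n : ℤ) :
    ExtVan (K n) := by
  intro i Q hQ
  induction i generalizing n with
  | zero =>
    obtain ⟨P, ι, π, h1, h2, h3⟩ := h n
    have : Projective P := (IsProjective.iff_projective (R := R) P).1 h1
    exact h2.ext_one Q (h3 Q hQ)
  | succ i ih =>
    obtain ⟨P, ι, π, h1, h2, h3⟩ := h n
    have : Projective P := (IsProjective.iff_projective (R := R) P).1 h1
    exact h2.ext_right Q (i + 1) (ih _) (Abelian.Ext.subsingleton_of_projective _ _ _)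

lemma QuasiGorensteinProjective.step {M : ModuleCat.{u} R} (h : QuasiGorensteinProjective M) :
    ∃ C, QuasiGorensteinProjective C ∧ QStep M C := by
  obtain ⟨K, hK, ⟨e⟩⟩ := (qgp_iff M).1 h
  refine ⟨K (-1), (qgp_iff _).2 ⟨fun n => K (n - 1), fun n => ?_, ⟨Iso.refl _⟩⟩,
    (hK (-1)).iso_left e⟩
  have := hK (n - 1)
  rwa [show n - 1 + 1 = n + 1 - 1 by ring] at this

lemma QuasiGorensteinProjective.of_iso {M N : ModuleCat.{u} R} (h : QuasiGorensteinProjective M)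
    (e : N ≅ M) : QuasiGorensteinProjective N := by
  obtain ⟨K, hK, ⟨e'⟩⟩ := (qgp_iff M).1 h
  exact (qgp_iff N).2 ⟨K, hK, ⟨e ≪≫ e'⟩⟩

lemma ExtVan.of_iso {M N : ModuleCat.{u} R} (h : ExtVan M) (e : N ≅ M) : ExtVan N := by
  intro i Q hQ
  have hs : SES (0 : ModuleCat.of R PUnit.{u+1} ⟶ N) e.hom :=
    ⟨fun x y _ => Subsingleton.elim _ _, e.toLinearEquiv.surjective, by
      intro y
      constructor
      · intro hy
        exact ⟨0, by simpa using (e.toLinearEquiv.injective (by simpa using hy) : y = 0).symm⟩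
      · rintro ⟨a, rfl⟩
        simp⟩
  have : Projective (ModuleCat.of R PUnit.{u+1}) :=
    (IsProjective.iff_projective (R := R) PUnit.{u+1}).1 inferInstance
  exact hs.ext_mid Q (i + 1) (Abelian.Ext.subsingleton_of_projective _ _ _) (h i Q hQ)

lemma QuasiGorensteinProjective.extVan {M : ModuleCat.{u} R} (h : QuasiGorensteinProjective M) :
    ExtVan M := by
  obtain ⟨K, hK, ⟨e⟩⟩ := (qgp_iff M).1 h
  exact (QStep.extVan hK 0).of_iso e

lemma SES.qstep {A P C : ModuleCat.{u} R} {f : A ⟶ P} {g : P ⟶ C} (h : SES f g)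
    (hP : Module.Projective R P) (hC : ExtVan C) : QStep A C :=
  ⟨P, f, g, hP, h, fun Q hQ k => h.extend Q (hC 0 Q hQ) k⟩

lemma SES.extVan_left {A B C : ModuleCat.{u} R} {f : A ⟶ B} {g : B ⟶ C} (h : SES f g)
    (hB : ExtVan B) (hC : ExtVan C) : ExtVan A :=
  fun i Q hQ => h.ext_left Q (i + 1) (hB i Q hQ) (hC (i + 1) Q hQ)

lemma SES.extVan_mid {A B C : ModuleCat.{u} R} {f : A ⟶ B} {g : B ⟶ C} (h : SES f g)
    (hA : ExtVan A) (hC : ExtVan C) : ExtVan B :=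
  fun i Q hQ => h.ext_mid Q (i + 1) (hA i Q hQ) (hC i Q hQ)

lemma extVan_of_projective (P : ModuleCat.{u} R) (hP : Module.Projective R P) : ExtVan P := by
  intro i Q hQ
  have : Projective P := (IsProjective.iff_projective (R := R) P).1 hP
  exact Abelian.Ext.subsingleton_of_projective _ _ _

lemma exists_syzygy (M : ModuleCat.{u} R) (hM : ExtVan M) : ∃ A, ExtVan A ∧ QStep A M := by
  let p : (M →₀ R) →ₗ[R] M := Finsupp.linearCombination R id
  let ι : ModuleCat.of R (LinearMap.ker p) ⟶ ModuleCat.of R (M →₀ R) :=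
    ModuleCat.ofHom (LinearMap.ker p).subtype
  let π : ModuleCat.of R (M →₀ R) ⟶ M := ModuleCat.ofHom p
  have hs : SES ι π :=
    ⟨Subtype.val_injective, Finsupp.linearCombination_id_surjective R M,
      LinearMap.exact_subtype_ker_map p⟩
  have hP : Module.Projective R (ModuleCat.of R (M →₀ R)) :=
    inferInstanceAs (Module.Projective R (M →₀ R))
  exact ⟨_, hs.extVan_left (extVan_of_projective _ hP) hM, hs.qstep hP hM⟩

lemma exists_iterate (S : ModuleCat.{u} R → Prop) (r : ModuleCat.{u} R → ModuleCat.{u} R → Prop)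
    (h : ∀ X, S X → ∃ Y, S Y ∧ r X Y) (X : ModuleCat.{u} R) (hX : S X) :
    ∃ a : ℕ → ModuleCat.{u} R, a 0 = X ∧ ∀ k, r (a k) (a (k + 1)) := by
  choose F hF hr using h
  let b : ℕ → {X // S X} := fun k => Nat.rec ⟨X, hX⟩ (fun _ Y => ⟨F Y.1 Y.2, hF Y.1 Y.2⟩) k
  exact ⟨fun k => (b k).1, rfl, fun k => hr (b k).1 (b k).2⟩

lemma qgp_coinduction (S : ModuleCat.{u} R → Prop) (hW : ∀ X, S X → ExtVan X)
    (h : ∀ X, S X → ∃ (P C : ModuleCat.{u} R) (f : X ⟶ P) (g : P ⟶ C),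
      Module.Projective R P ∧ SES f g ∧ S C) (X : ModuleCat.{u} R) (hX : S X) :
    QuasiGorensteinProjective X := by
  obtain ⟨b, hb0, hb⟩ := exists_iterate S (fun X C => QStep X C) (by
    intro X hX
    obtain ⟨P, C, f, g, hP, hs, hC⟩ := h X hX
    exact ⟨C, hC, hs.qstep hP (hW _ hC)⟩) X hX
  obtain ⟨a, ha0, ha⟩ := exists_iterate ExtVan (fun X A => QStep A X)
    (fun X hX => exists_syzygy X hX) X (hW X hX)
  refine (qgp_iff X).2 ⟨fun n => match n with
    | Int.ofNat k => a k
    | Int.negSucc k => b (k + 1), fun n => ?_, ⟨eqToIso ha0.symm⟩⟩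
  match n with
  | Int.ofNat k => exact ha k
  | Int.negSucc 0 =>
    change QStep (a 0) (b 1)
    rw [ha0, ← hb0]
    exact hb 0
  | Int.negSucc (k + 1) => exact hb (k + 1)

lemma QuasiGorensteinProjective.embed {M : ModuleCat.{u} R} (h : QuasiGorensteinProjective M) :
    ∃ (P C : ModuleCat.{u} R) (f : M ⟶ P) (g : P ⟶ C),
      Module.Projective R P ∧ SES f g ∧ QuasiGorensteinProjective C := by
  obtain ⟨C, hC, P, f, g, hP, hs, -⟩ := h.step
  exact ⟨P, C, f, g, hP, hs, hC⟩

lemma qgp_of_embed {K P C : ModuleCat.{u} R} {f : K ⟶ P} {g : P ⟶ C} (hP : Module.Projective R P)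
    (hs : SES f g) (hC : QuasiGorensteinProjective C) : QuasiGorensteinProjective K := by
  refine qgp_coinduction (fun X => QuasiGorensteinProjective X ∨ X = K) ?_ ?_ K (Or.inr rfl)
  · rintro X (hX | rfl)
    · exact hX.extVan
    · exact hs.extVan_left (extVan_of_projective P hP) hC.extVan
  · rintro X (hX | rfl)
    · obtain ⟨P, C, f, g, hP, hs, hC⟩ := hX.embed
      exact ⟨P, C, f, g, hP, hs, Or.inl hC⟩
    · exact ⟨P, C, f, g, hP, hs, Or.inl hC⟩

lemma ses_id (P : ModuleCat.{u} R) :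
    SES (𝟙 P) (0 : P ⟶ ModuleCat.of R PUnit.{u+1}) :=
  ⟨fun _ _ h => h, fun y => ⟨0, Subsingleton.elim _ _⟩, fun y => by simp⟩

lemma ses_id' (P : ModuleCat.{u} R) :
    SES (0 : ModuleCat.of R PUnit.{u+1} ⟶ P) (𝟙 P) :=
  ⟨fun _ _ _ => Subsingleton.elim _ _, fun y => ⟨y, rfl⟩, fun y => by simp [eq_comm]⟩

lemma qgp_of_projective (P : ModuleCat.{u} R) (hP : Module.Projective R P) :
    QuasiGorensteinProjective P := by
  refine qgp_coinduction (fun X => Module.Projective R X) extVan_of_projective ?_ P hP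
  intro X hX
  exact ⟨X, _, _, _, hX, ses_id X, inferInstanceAs (Module.Projective R PUnit.{u+1})⟩

/-- The quotient short exact sequence of an injection. -/
lemma exists_coker {A B : ModuleCat.{u} R} (f : A ⟶ B) (hf : Function.Injective f) :
    ∃ (C : ModuleCat.{u} R) (g : B ⟶ C), SES f g :=
  ⟨ModuleCat.of R (B ⧸ LinearMap.range f.hom), ModuleCat.ofHom (LinearMap.range f.hom).mkQ, hf,
    Submodule.mkQ_surjective _, LinearMap.exact_map_mkQ_range f.hom⟩

lemma QuasiGorensteinProjective.extension {A B C : ModuleCat.{u} R} {f : A ⟶ B} {g : B ⟶ C}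
    (hs : SES f g) (hA : QuasiGorensteinProjective A) (hC : QuasiGorensteinProjective C) :
    QuasiGorensteinProjective B := by
  refine qgp_coinduction (fun B => ∃ (A C : ModuleCat.{u} R) (f : A ⟶ B) (g : B ⟶ C), SES f g ∧
    QuasiGorensteinProjective A ∧ QuasiGorensteinProjective C) ?_ ?_ B ⟨A, C, f, g, hs, hA, hC⟩
  · rintro B ⟨A, C, f, g, hs, hA, hC⟩
    exact hs.extVan_mid hA.extVan hC.extVan
  clear hs hA hC
  rintro B ⟨A, C, f, g, hs, hA, hC⟩
  obtain ⟨P₁, A₁, i, p, hP₁, hs₁, hA₁⟩ := hA.embed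
  obtain ⟨P₂, C₁, j, q, hP₂, hs₂, hC₁⟩ := hC.embed
  obtain ⟨e, he⟩ := hs.extend P₁ (hC.extVan 0 P₁ (quasiProjective_of_projective P₁ hP₁)) i
  have he' : ∀ a, e (f a) = i a := fun a => congr($he a)
  let k : B ⟶ ModuleCat.of R (P₁ × P₂) := ModuleCat.ofHom (e.hom.prod (g ≫ j).hom)
  have hk : ∀ b, k b = (e b, j (g b)) := fun b => rfl
  have hkinj : Function.Injective k := by
    refine (injective_iff_map_eq_zero k.hom).2 fun b hb => ?_
    have h1 : e b = 0 := congr_arg Prod.fst hb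
    have h2 : j (g b) = 0 := congr_arg Prod.snd hb
    have h3 : g b = 0 := hs₂.inj (by simpa using h2)
    obtain ⟨a, rfl⟩ := (hs.exact b).1 h3
    rw [he'] at h1
    have : a = 0 := hs₁.inj (by simpa using h1)
    simp [this]
  obtain ⟨D, d, hd⟩ := exists_coker k hkinj
  obtain ⟨u', hu⟩ := hs₁.desc (ModuleCat.ofHom (LinearMap.inl R P₁ P₂) ≫ d) (by
    ext a
    refine (hd.exact (i a, 0)).2 ⟨f a, ?_⟩
    rw [hk, he', hs.exact.apply_apply_eq_zero, map_zero])
  obtain ⟨v, hv⟩ := hd.desc (ModuleCat.ofHom (LinearMap.snd R P₁ P₂) ≫ q) (by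
    ext b
    exact hs₂.exact.apply_apply_eq_zero (g b))
  have hu' : ∀ x, u' (p x) = d (x, 0) := hu
  have hv' : ∀ x : P₁, ∀ y : P₂, v (d (x, y)) = q y := fun x y => hv (x, y)
  refine ⟨_, D, k, d, ?_, hd, A₁, C₁, u', v, ⟨?_, ?_, ?_⟩, hA₁, hC₁⟩
  · exact inferInstanceAs (Module.Projective R (P₁ × P₂))
  · refine (injective_iff_map_eq_zero u'.hom).2 fun a ha => ?_
    obtain ⟨x, rfl⟩ := hs₁.surj a
    have ha : d (x, 0) = 0 := by rw [← hu']; exact ha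
    obtain ⟨b, hb⟩ := (hd.exact _).1 ha
    rw [hk] at hb
    have h1 : e b = x := congr_arg Prod.fst hb
    have h2 : j (g b) = 0 := congr_arg Prod.snd hb
    have h3 : g b = 0 := hs₂.inj (by simpa using h2)
    obtain ⟨a, rfl⟩ := (hs.exact b).1 h3
    rw [← h1, he']
    exact hs₁.exact.apply_apply_eq_zero a
  · intro c
    obtain ⟨y, rfl⟩ := hs₂.surj c
    exact ⟨d (0, y), hv' 0 y⟩
  · intro z
    obtain ⟨⟨x, y⟩, rfl⟩ := hd.surj z
    rw [hv']
    constructor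
    · intro hy
      obtain ⟨c, rfl⟩ := (hs₂.exact y).1 hy
      obtain ⟨b, rfl⟩ := hs.surj c
      refine ⟨p (x - e b), ?_⟩
      rw [hu']
      have h0 : d (k b) = 0 := hd.exact.apply_apply_eq_zero b
      have h1 : ((x - e b, 0) : P₁ × P₂) = (x, j (g b)) - k b := by
        rw [hk]; simp
      have h2 := map_sub d.hom ((x, j (g b)) : P₁ × P₂) (k b)
      rw [h1]
      refine h2.trans ?_
      rw [h0, sub_zero]
    · rintro ⟨a, ha⟩
      obtain ⟨x', rfl⟩ := hs₁.surj a
      rw [← hv' x y, ← ha, hu', hv', map_zero]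

lemma qgp_of_ses {L G K : ModuleCat.{u} R} {f : L ⟶ G} {g : G ⟶ K} (hs : SES f g)
    (hL : QuasiGorensteinProjective L) (hG : QuasiGorensteinProjective G) (hK : ExtVan K) :
    QuasiGorensteinProjective K := by
  obtain ⟨P, L₁, i, p, hP, hs₁, hL₁⟩ := hL.embed
  obtain ⟨e, he⟩ := hs.extend P (hK 0 P (quasiProjective_of_projective P hP)) i
  have he' : ∀ a, e (f a) = i a := fun a => congr($he a)
  let k : G ⟶ ModuleCat.of R (K × P) := ModuleCat.ofHom (g.hom.prod e.hom)
  have hk : ∀ b, k b = (g b, e b) := fun b => rfl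
  obtain ⟨t, ht⟩ := hs.desc (e ≫ p) (by
    ext a
    refine (congr_arg p (he' a)).trans (hs₁.exact.apply_apply_eq_zero a))
  have ht' : ∀ x, t (g x) = p (e x) := ht
  let v : ModuleCat.of R (K × P) ⟶ L₁ :=
    ModuleCat.ofHom (p.hom ∘ₗ LinearMap.snd R K P - t.hom ∘ₗ LinearMap.fst R K P)
  have hv : ∀ (x : K) (y : P), v (x, y) = p y - t x := fun x y => rfl
  have hsk : SES k v := by
    refine ⟨?_, ?_, ?_⟩
    · refine (injective_iff_map_eq_zero k.hom).2 fun b hb => ?_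
      have h1 : g b = 0 := congr_arg Prod.fst hb
      have h2 : e b = 0 := congr_arg Prod.snd hb
      obtain ⟨a, rfl⟩ := (hs.exact b).1 h1
      rw [he'] at h2
      have : a = 0 := hs₁.inj (by simpa using h2)
      simp [this]
    · intro c
      obtain ⟨y, rfl⟩ := hs₁.surj c
      exact ⟨(0, y), by rw [hv]; simp⟩
    · rintro ⟨x, y⟩
      obtain ⟨x, rfl⟩ := hs.surj x
      rw [hv, ht']
      constructor
      · intro h
        rw [← map_sub] at h
        obtain ⟨a, ha⟩ := (hs₁.exact _).1 h
        refine ⟨x + f a, ?_⟩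
        rw [hk, map_add, map_add, hs.exact.apply_apply_eq_zero, he', ha]
        simp
      · rintro ⟨b, hb⟩
        rw [hk] at hb
        have h1 : g b = g x := congr_arg Prod.fst hb
        have h2 : e b = y := congr_arg Prod.snd hb
        rw [← h2, ← ht', ← ht', h1, sub_self]
  have hD : QuasiGorensteinProjective (ModuleCat.of R (K × P)) :=
    QuasiGorensteinProjective.extension hsk hG hL₁
  obtain ⟨P₀, D, j, q, hP₀, hs₂, hD'⟩ := hD.embed
  let m : K ⟶ P₀ := ModuleCat.ofHom (LinearMap.inl R K P) ≫ j
  have hm : ∀ x, m x = j (x, 0) := fun x => rfl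
  have hminj : Function.Injective m := by
    intro x y hxy
    exact congr_arg Prod.fst (hs₂.inj hxy)
  obtain ⟨C, c, hc⟩ := exists_coker m hminj
  obtain ⟨w, hw⟩ := hc.desc q (by
    ext x
    exact hs₂.exact.apply_apply_eq_zero _)
  let n : P ⟶ C := ModuleCat.ofHom (LinearMap.inr R K P) ≫ j ≫ c
  have hn : ∀ y, n y = c (j (0, y)) := fun y => rfl
  have hsC : SES n w := by
    refine ⟨?_, ?_, ?_⟩
    · refine (injective_iff_map_eq_zero n.hom).2 fun y hy => ?_
      obtain ⟨x, hx⟩ := (hc.exact _).1 hy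
      exact (congr_arg Prod.snd (hs₂.inj hx)).symm
    · intro z
      obtain ⟨y, rfl⟩ := hs₂.surj z
      exact ⟨c y, hw y⟩
    · intro z
      obtain ⟨z, rfl⟩ := hc.surj z
      rw [hw]
      constructor
      · intro h
        obtain ⟨⟨x, y⟩, rfl⟩ := (hs₂.exact z).1 h
        refine ⟨y, ?_⟩
        have h1 : ((x, y) : K × P) = (x, 0) + (0, y) := by simp
        have h2 := map_add (j ≫ c).hom ((x, 0) : K × P) (0, y)
        rw [hn, h1]
        refine Eq.trans ?_ h2.symm
        have h3 : c (m x) = 0 := hc.exact.apply_apply_eq_zero x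
        change _ = c (m x) + c (j (0, y))
        rw [h3, zero_add]
      · rintro ⟨y, hy⟩
        rw [← hw, ← hy, hn, hw]
        exact hs₂.exact.apply_apply_eq_zero _
  exact qgp_of_embed hP₀ hc
    (QuasiGorensteinProjective.extension hsC (qgp_of_projective P hP) hD')

lemma qgp_of_finite (m : ℕ) (K : ModuleCat.{u} R) (h : qgpdimLE m K) (hK : ExtVan K) :
    QuasiGorensteinProjective K := by
  induction m generalizing K with
  | zero => exact h
  | succ m ih =>
    obtain ⟨L, G, f, g, hG, h1, h2, h3, hL⟩ := h
    have hs : SES f g := ⟨h1, h2, h3⟩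
    exact qgp_of_ses hs (ih L hL (hs.extVan_left hG.extVan hK)) hG hK

lemma qgpdimLE_punit (n : ℕ) : qgpdimLE n (ModuleCat.of R PUnit.{u+1}) := by
  induction n with
  | zero => exact qgp_of_projective _ (inferInstanceAs (Module.Projective R PUnit.{u+1}))
  | succ n ih =>
    have hs := ses_id' (ModuleCat.of R PUnit.{u+1})
    exact ⟨_, _, _, _, qgp_of_projective _ (inferInstanceAs (Module.Projective R PUnit.{u+1})),
      hs.inj, hs.surj, hs.exact, ih⟩

lemma qgpdimLE_of_ext (n m : ℕ) (M : ModuleCat.{u} R) (h : qgpdimLE m M)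
    (hE : ∀ (i : ℕ) (Q : ModuleCat.{u} R), QuasiProjective Q →
      Subsingleton (Abelian.Ext.{u} M Q (n + i + 1))) : qgpdimLE n M := by
  induction n generalizing m M with
  | zero =>
    refine qgp_of_finite m M h fun i Q hQ => ?_
    have := hE i Q hQ
    rwa [zero_add] at this
  | succ n ih =>
    cases m with
    | zero =>
      have hs := ses_id' M
      exact ⟨_, _, _, _, h, hs.inj, hs.surj, hs.exact, qgpdimLE_punit n⟩
    | succ m =>
      obtain ⟨L, G, f, g, hG, h1, h2, h3, hL⟩ := h
      have hs : SES f g := ⟨h1, h2, h3⟩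
      refine ⟨L, G, f, g, hG, h1, h2, h3, ih m L hL fun i Q hQ => ?_⟩
      refine hs.ext_left Q (n + i + 1) (hG.extVan (n + i) Q hQ) ?_
      have := hE i Q hQ
      rwa [show n + 1 + i + 1 = n + i + 1 + 1 by ring] at this

lemma ext_of_qgpdimLE (n : ℕ) (M : ModuleCat.{u} R) (h : qgpdimLE n M) (i : ℕ)
    (Q : ModuleCat.{u} R) (hQ : QuasiProjective Q) :
    Subsingleton (Abelian.Ext.{u} M Q (n + i + 1)) := by
  induction n generalizing M with
  | zero =>
    have := QuasiGorensteinProjective.extVan h i Q hQ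
    rwa [zero_add]
  | succ n ih =>
    obtain ⟨L, G, f, g, hG, h1, h2, h3, hL⟩ := h
    have hs : SES f g := ⟨h1, h2, h3⟩
    rw [show n + 1 + i + 1 = n + i + 1 + 1 by ring]
    exact hs.ext_right Q (n + i + 1) (ih L hL) (hG.extVan (n + i + 1) Q hQ)

/-- For `M` of finite quasi-Gorenstein projective dimension and `n ≥ 1`:
the dimension is at most `n` iff `Ext^{n+i}(M, Q) = 0` for all `i ≥ 1` and all
quasi-projective `Q`. -/
theorem qgpdimLE_iff_ext_vanishing (M : ModuleCat.{u} R)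
    (hfin : ∃ m : ℕ, qgpdimLE m M) (n : ℕ) (hn : 1 ≤ n) :
    qgpdimLE n M ↔
      ∀ (i : ℕ), 1 ≤ i → ∀ Q : ModuleCat.{u} R, QuasiProjective Q →
        Subsingleton (((Ext ℤ (ModuleCat.{u} R) (n + i)).obj (Opposite.op M)).obj Q) := by
  constructor
  · intro h i hi Q hQ
    obtain ⟨i, rfl⟩ := Nat.exists_eq_add_of_le' hi
    exact (old_ext_iff M Q (n + i)).2 (ext_of_qgpdimLE n M h i Q hQ)
  · intro h
    obtain ⟨m, hm⟩ := hfin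
    exact qgpdimLE_of_ext n m M hm fun i Q hQ =>
      (old_ext_iff M Q (n + i)).1 (h (i + 1) (Nat.le_add_left 1 i) Q hQ)
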